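/- Let 0 < ε ≤ 1/2 and A > 0. Then there exists a constant K > 0 such that for all integers n ≥ 1 and r ≥ 1 with r ≤ A·n^{1/2−ε}, the probability that a random lattice path of length n has exactly r zeros satisfies | r(r+1) · ( (1/(n+1)) Σ_{ℓ=0}^{n} (1/C(n,ℓ)) · #{w ∈ P(n,ℓ) : Z(w) = r} ) − 1 | ≤ K / n^{2ε}. In particular, for each fixed r ≥ 1, this probability tends to 1/(r(r+1)) as n → ∞. -/

import Mathlib

/-- The step value of a lattice path: `true` is an up-step (+1), `false` a down-step (−1). -/
def pathStep (b : Bool) : ℤ := if b then 1 else -1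

/-- Partial sum `s_t(w) = Σ_{i<t} w(i)` of a lattice path of length `n`. -/
def psum {n : ℕ} (w : Fin n → Bool) (t : ℕ) : ℤ :=
  ∑ i ∈ Finset.univ.filter (fun i : Fin n => (i : ℕ) < t), pathStep (w i)

/-- `P(n,ℓ)`: lattice paths of length `n` with exactly `ℓ` down-steps. -/
def paths (n ℓ : ℕ) : Finset (Fin n → Bool) :=
  Finset.univ.filter (fun w => (Finset.univ.filter (fun i => w i = false)).card = ℓ)

/-- `Z(w)`: the number of zeros of the lattice path `w`. -/
def numZeros {n : ℕ} (w : Fin n → Bool) : ℕ :=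
  ((Finset.range (n + 1)).filter (fun t => psum w t = 0)).card

/-- The probability that a random lattice path of length `n` has exactly `r` zeros. -/
noncomputable def probZeros (n r : ℕ) : ℝ :=
  (1 / ((n : ℝ) + 1)) * ∑ ℓ ∈ Finset.range (n + 1),
    (1 / (n.choose ℓ : ℝ)) * (((paths n ℓ).filter (fun w => numZeros w = r)).card : ℝ)

section ZeroProbabilities

open Finset

/-- Number of paths of length `n` with `ℓ` down-steps and more than `s` zeros. -/
def pathsZerosGT (n ℓ s : ℕ) : ℕ :=
  ((paths n ℓ).filter (fun w => s < numZeros w)).card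

lemma psum_snoc_of_le {n : ℕ} (w : Fin n → Bool) (b : Bool) {t : ℕ} (ht : t ≤ n) :
    psum (Fin.snoc w b : Fin (n + 1) → Bool) t = psum w t := by
  unfold psum
  rw [sum_filter, sum_filter, Fin.sum_univ_castSucc]
  simp [ht]

lemma psum_snoc_last {n : ℕ} (w : Fin n → Bool) (b : Bool) :
    psum (Fin.snoc w b : Fin (n + 1) → Bool) (n + 1) = psum w n + pathStep b := by
  unfold psum
  rw [sum_filter, sum_filter, Fin.sum_univ_castSucc]
  simp

lemma card_down_snoc {n : ℕ} (w : Fin n → Bool) (b : Bool) :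
    (univ.filter (fun i => (Fin.snoc w b : Fin (n + 1) → Bool) i = false)).card =
      (univ.filter (fun i => w i = false)).card + if b then 0 else 1 := by
  rw [card_filter, card_filter, Fin.sum_univ_castSucc]
  cases b <;> simp

lemma psum_length {n : ℕ} (w : Fin n → Bool) :
    psum w n = n - 2 * ((univ.filter (fun i => w i = false)).card : ℤ) := by
  have hstep : ∀ i, pathStep (w i) = 1 - 2 * (if w i = false then 1 else 0 : ℤ) := by
    intro i
    cases w i <;> simp [pathStep]
  unfold psum
  rw [filter_true_of_mem (fun i _ => i.isLt)]
  simp only [hstep, sum_sub_distrib, ← mul_sum, card_filter]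
  simp

lemma numZeros_snoc {n : ℕ} (w : Fin n → Bool) (b : Bool) :
    numZeros (Fin.snoc w b : Fin (n + 1) → Bool) =
      numZeros w + if psum (Fin.snoc w b : Fin (n + 1) → Bool) (n + 1) = 0 then 1 else 0 := by
  unfold numZeros
  rw [card_filter, card_filter, sum_range_succ _ (n + 1)]
  congr 1
  refine sum_congr rfl fun t ht => ?_
  rw [psum_snoc_of_le w b (by simpa [Nat.lt_succ_iff] using ht)]

lemma numZeros_pos {n : ℕ} (w : Fin n → Bool) : 0 < numZeros w :=
  card_pos.2 ⟨0, by simp [psum, sum_filter]⟩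

lemma card_filter_snoc {n : ℕ} (p : (Fin (n + 1) → Bool) → Prop) [DecidablePred p] :
    (univ.filter p).card =
      (univ.filter (fun w : Fin n → Bool => p (Fin.snoc w true))).card +
        (univ.filter (fun w : Fin n → Bool => p (Fin.snoc w false))).card := by
  simp only [card_filter]
  rw [← (Fin.snocEquiv (fun _ : Fin (n + 1) => Bool)).sum_comp, Fintype.sum_prod_type,
    Fintype.sum_bool]
  rfl

/-- The new zero created by a last step to height `n + 1 - 2 * ℓ`. -/
lemma numZeros_snoc_of_card {n ℓ : ℕ} (w : Fin n → Bool) (b : Bool)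
    (h : (univ.filter (fun i => w i = false)).card + (if b then 0 else 1) = ℓ) :
    numZeros (Fin.snoc w b : Fin (n + 1) → Bool) =
      numZeros w + if 2 * ℓ = n + 1 then 1 else 0 := by
  rw [numZeros_snoc, psum_length, card_down_snoc, h]
  congr 1
  refine if_congr ?_ rfl rfl
  push_cast
  omega

/-- Decomposition by the last step: an up-step or a down-step to the height of index `ℓ + 1`. -/
lemma pathsZerosGT_succ_succ (n ℓ s : ℕ) :
    pathsZerosGT (n + 1) (ℓ + 1) s =
      ((paths n (ℓ + 1)).filter
        (fun w => s < numZeros w + if 2 * (ℓ + 1) = n + 1 then 1 else 0)).card +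
      ((paths n ℓ).filter
        (fun w => s < numZeros w + if 2 * (ℓ + 1) = n + 1 then 1 else 0)).card := by
  unfold pathsZerosGT paths
  simp only [filter_filter]
  rw [card_filter_snoc]
  congr 2 <;> ext w <;> simp only [mem_filter, mem_univ, true_and, card_down_snoc]
  · exact (and_congr_right fun h => by
      rw [numZeros_snoc_of_card w true (ℓ := ℓ + 1) (by simpa using h)]).trans (by simp)
  · exact (and_congr_right fun h => by
      rw [numZeros_snoc_of_card w false (ℓ := ℓ + 1) (by simpa using h)]).trans (by simp)

lemma pathsZerosGT_succ_zero (n s : ℕ) :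
    pathsZerosGT (n + 1) 0 s = pathsZerosGT n 0 s := by
  unfold pathsZerosGT paths
  simp only [filter_filter]
  rw [card_filter_snoc]
  simp only [card_down_snoc]
  have h : (univ.filter (fun w : Fin n → Bool =>
      (univ.filter (fun i => w i = false)).card + (if false then 0 else 1) = 0 ∧
        s < numZeros (Fin.snoc w false : Fin (n + 1) → Bool))).card = 0 := by
    simp
  simp only [Bool.false_eq_true, if_false] at h ⊢
  rw [h, add_zero]
  congr 1
  ext w
  simp only [mem_filter, mem_univ, true_and]
  exact (and_congr_right fun h => by
      rw [numZeros_snoc_of_card w true (ℓ := 0) (by simpa using h)]).trans (by simp)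

lemma pathsZerosGT_of_two_mul_ne {n ℓ : ℕ} (s : ℕ) (h : 2 * (ℓ + 1) ≠ n + 1) :
    pathsZerosGT (n + 1) (ℓ + 1) s = pathsZerosGT n (ℓ + 1) s + pathsZerosGT n ℓ s := by
  rw [pathsZerosGT_succ_succ]
  simp only [h, if_false, add_zero, pathsZerosGT]

lemma pathsZerosGT_of_two_mul_eq {n ℓ : ℕ} (s : ℕ) (h : 2 * (ℓ + 1) = n + 1) :
    pathsZerosGT (n + 1) (ℓ + 1) s =
      pathsZerosGT n (ℓ + 1) (s - 1) + pathsZerosGT n ℓ (s - 1) := by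
  have hs : ∀ w : Fin n → Bool, s < numZeros w + 1 ↔ s - 1 < numZeros w := fun w => by
    have := numZeros_pos w
    omega
  rw [pathsZerosGT_succ_succ]
  simp only [h, if_true, hs, pathsZerosGT]

lemma pathsZerosGT_eq_zero {n s : ℕ} (ℓ : ℕ) (h : n < s) : pathsZerosGT n ℓ s = 0 := by
  refine card_eq_zero.2 (filter_eq_empty_iff.2 fun w _ hw => ?_)
  have : numZeros w ≤ n + 1 := (card_filter_le _ _).trans (card_range _).le
  omega

lemma pathsZerosGT_eq (n ℓ s : ℕ) (hs : s ≤ n) :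
    pathsZerosGT n ℓ s = 2 ^ s * (n - s).choose (max ℓ (n - ℓ)) := by
  induction n generalizing ℓ s with
  | zero =>
    obtain rfl : s = 0 := by omega
    cases ℓ with
    | zero =>
      rw [pathsZerosGT, filter_true_of_mem fun w _ => numZeros_pos w]
      simp [paths]
    | succ ℓ => simp [pathsZerosGT, paths]
  | succ n ih =>
    rcases ℓ with _ | ℓ
    · rw [pathsZerosGT_succ_zero]
      rcases hs.eq_or_lt with rfl | hs
      · simp [pathsZerosGT_eq_zero]
      · rw [ih 0 s (by omega)]
        rcases s with _ | s
        · simp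
        · rw [Nat.choose_eq_zero_of_lt (by omega), Nat.choose_eq_zero_of_lt (by omega)]
    by_cases h : 2 * (ℓ + 1) = n + 1
    · rw [pathsZerosGT_of_two_mul_eq s h, ih _ _ (by omega), ih _ _ (by omega)]
      obtain rfl : n = 2 * ℓ + 1 := by omega
      rw [show max (ℓ + 1) (2 * ℓ + 1 - (ℓ + 1)) = ℓ + 1 by omega,
        show max ℓ (2 * ℓ + 1 - ℓ) = ℓ + 1 by omega,
        show max (ℓ + 1) (2 * ℓ + 1 + 1 - (ℓ + 1)) = ℓ + 1 by omega]
      rcases s with _ | s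
      · have : (2 * ℓ + 1).choose ℓ = (2 * ℓ + 1).choose (ℓ + 1) :=
          Nat.choose_symm_of_eq_add (by omega)
        simp [Nat.choose_succ_succ, this]
      · simp only [Nat.add_sub_add_right, Nat.add_sub_cancel]
        ring
    · rw [pathsZerosGT_of_two_mul_ne s h]
      rcases hs.eq_or_lt with rfl | hs
      · rw [pathsZerosGT_eq_zero _ (by omega), pathsZerosGT_eq_zero _ (by omega),
          Nat.choose_eq_zero_of_lt (by omega)]
        simp
      · rw [ih _ _ (by omega), ih _ _ (by omega), ← mul_add, Nat.succ_sub (by omega)]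
        congr 1
        rcases lt_or_ge (n - ℓ) (ℓ + 1) with hl | hl
        · rw [show max (ℓ + 1) (n + 1 - (ℓ + 1)) = ℓ + 1 by omega,
            show max (ℓ + 1) (n - (ℓ + 1)) = ℓ + 1 by omega,
            show max ℓ (n - ℓ) = ℓ by omega, Nat.choose_succ_succ, add_comm]
        · obtain ⟨k, hk⟩ : ∃ k, n - ℓ = k + 1 := ⟨n - ℓ - 1, by omega⟩
          rw [show max (ℓ + 1) (n + 1 - (ℓ + 1)) = k + 1 by omega,
            show max (ℓ + 1) (n - (ℓ + 1)) = k by omega,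
            show max ℓ (n - ℓ) = k + 1 by omega, Nat.choose_succ_succ]

lemma pathsZerosGT_mul_choose {n ℓ : ℕ} (s : ℕ) (hℓ : ℓ ≤ n) :
    pathsZerosGT n ℓ s * n.choose s = 2 ^ s * (min ℓ (n - ℓ)).choose s * n.choose ℓ := by
  have hsymm : n.choose ℓ = n.choose (min ℓ (n - ℓ)) := by
    rcases le_total ℓ (n - ℓ) with h | h
    · rw [min_eq_left h]
    · rw [min_eq_right h, Nat.choose_symm hℓ]
  rcases lt_or_ge (min ℓ (n - ℓ)) s with h | h
  · rw [Nat.choose_eq_zero_of_lt h]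
    rcases lt_or_ge n s with hn | hn
    · simp [pathsZerosGT_eq_zero ℓ hn]
    · rw [pathsZerosGT_eq n ℓ s hn, Nat.choose_eq_zero_of_lt (by omega)]
      simp
  · rw [pathsZerosGT_eq n ℓ s (by omega), hsymm, Nat.choose_symm_of_eq_add
      (show n - s = max ℓ (n - ℓ) + (min ℓ (n - ℓ) - s) by omega), mul_assoc, mul_assoc]
    congr 1
    rw [mul_comm, ← Nat.choose_mul h, mul_comm]

lemma sum_range_choose_right (M s : ℕ) :
    ∑ i ∈ range M, i.choose s = M.choose (s + 1) := by
  induction M with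
  | zero => simp
  | succ M ih => rw [sum_range_succ, ih, Nat.choose_succ_succ, add_comm]

lemma sum_choose_min (n s : ℕ) :
    ∑ ℓ ∈ range (n + 1), (min ℓ (n - ℓ)).choose s =
      (n / 2 + 1).choose (s + 1) + ((n + 1) / 2).choose (s + 1) := by
  rw [show n + 1 = (n / 2 + 1) + (n + 1) / 2 by omega, sum_range_add,
    show (n / 2 + 1 + (n + 1) / 2) / 2 = (n + 1) / 2 by omega,
    ← sum_range_choose_right, ← sum_range_choose_right, ← sum_range_reflect _ ((n + 1) / 2)]
  congr 1 <;> refine sum_congr rfl fun i hi => ?_ <;> rw [mem_range] at hi <;> congr 1 <;> omega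

/-- The normalised tail `r * P(Z ≥ r)`, which depends on the length `n` only through
`N = ⌊n / 2⌋ + 1`. -/
noncomputable def zeroTail (N r : ℕ) : ℝ := 2 ^ r * (N.choose r : ℝ) / ((2 * N).choose r : ℝ)

lemma choose_add_choose_identity (n s : ℕ) :
    ((n / 2 + 1).choose (s + 1) + ((n + 1) / 2).choose (s + 1)) * (s + 1) *
        (2 * (n / 2 + 1)).choose (s + 1) =
      2 * ((n + 1) * n.choose s * (n / 2 + 1).choose (s + 1)) := by
  obtain ⟨m, rfl | rfl⟩ := Nat.even_or_odd' n
  · rw [show 2 * m / 2 = m by omega, show (2 * m + 1) / 2 = m by omega]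
    rcases lt_or_ge m s with hs | hs
    · simp [Nat.choose_eq_zero_of_lt (show m < s + 1 by omega),
        Nat.choose_eq_zero_of_lt (show m + 1 < s + 1 by omega)]
    have h1 := Nat.add_one_mul_choose_eq m s
    have h2 := Nat.choose_succ_right_eq m s
    have h3 := Nat.add_one_mul_choose_eq (2 * m + 1) s
    have h4 := Nat.choose_mul_succ_eq (2 * m) s
    obtain ⟨k, rfl⟩ := Nat.exists_eq_add_of_le hs
    rw [show 2 * (s + k) + 1 - s = s + 2 * k + 1 by omega] at h4
    rw [Nat.add_sub_cancel_left] at h2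
    rw [show 2 * (s + k) + 1 + 1 = 2 * (s + k + 1) by ring] at h3
    apply Nat.eq_of_mul_eq_mul_right (Nat.succ_pos s)
    zify at *
    generalize ((s + k + 1).choose (s + 1) : ℤ) = a at *
    generalize ((s + k).choose (s + 1) : ℤ) = b at *
    generalize ((2 * (s + k + 1)).choose (s + 1) : ℤ) = c at *
    generalize ((2 * (s + k) + 1).choose s : ℤ) = d at *
    generalize ((2 * (s + k)).choose s : ℤ) = e at *
    generalize ((s + k).choose s : ℤ) = f at *
    linear_combination (-c * (s + 1) + 2 * (2 * (s + k) + 1) * e) * h1 + c * (s + 1) * h2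
      - f * (s + 2 * k + 1) * h3 - f * (2 * (s + k + 1)) * h4
  · rw [show (2 * m + 1) / 2 = m by omega, show (2 * m + 1 + 1) / 2 = m + 1 by omega]
    have h := Nat.add_one_mul_choose_eq (2 * m + 1) s
    rw [h, show 2 * (m + 1) = 2 * m + 1 + 1 by ring]
    ring

/-- The probability of having more than `s` zeros. -/
lemma prob_pathsZerosGT (n s : ℕ) :
    (1 / ((n : ℝ) + 1)) * ∑ ℓ ∈ range (n + 1),
        (1 / (n.choose ℓ : ℝ)) * (pathsZerosGT n ℓ s : ℝ) =
      zeroTail (n / 2 + 1) (s + 1) / ((s : ℝ) + 1) := by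
  rcases lt_or_ge n s with hs | hs
  · simp [pathsZerosGT_eq_zero _ hs, zeroTail,
      Nat.choose_eq_zero_of_lt (show n / 2 + 1 < s + 1 by omega)]
  have hns : (n.choose s : ℝ) ≠ 0 := by exact_mod_cast (Nat.choose_pos hs).ne'
  have hNs : ((2 * (n / 2 + 1)).choose (s + 1) : ℝ) ≠ 0 := by
    exact_mod_cast (Nat.choose_pos (by omega)).ne'
  have hterm : ∀ ℓ ∈ range (n + 1), (1 / (n.choose ℓ : ℝ)) * (pathsZerosGT n ℓ s : ℝ) =
      2 ^ s / (n.choose s : ℝ) * ((min ℓ (n - ℓ)).choose s : ℝ) := fun ℓ hℓ => by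
    have hℓ' : ℓ ≤ n := by simpa [Nat.lt_succ_iff] using hℓ
    have hnℓ : (n.choose ℓ : ℝ) ≠ 0 := by exact_mod_cast (Nat.choose_pos hℓ').ne'
    have h : (pathsZerosGT n ℓ s * n.choose s : ℝ) =
      2 ^ s * (min ℓ (n - ℓ)).choose s * n.choose ℓ := by
        exact_mod_cast pathsZerosGT_mul_choose s hℓ'
    field_simp
    linear_combination h
  have hsum : (∑ ℓ ∈ range (n + 1), ((min ℓ (n - ℓ)).choose s : ℝ)) =
      (n / 2 + 1).choose (s + 1) + ((n + 1) / 2).choose (s + 1) := by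
    exact_mod_cast sum_choose_min n s
  have hid : (((n / 2 + 1).choose (s + 1) + ((n + 1) / 2).choose (s + 1)) * (s + 1) *
        (2 * (n / 2 + 1)).choose (s + 1) : ℝ) =
      2 * ((n + 1) * n.choose s * (n / 2 + 1).choose (s + 1)) := by
    exact_mod_cast choose_add_choose_identity n s
  rw [sum_congr rfl hterm, ← mul_sum, hsum, zeroTail]
  have hn : (n : ℝ) + 1 ≠ 0 := by positivity
  have hs' : (s : ℝ) + 1 ≠ 0 := by positivity
  rw [pow_succ]
  field_simp
  linear_combination hid

lemma card_filter_numZeros_eq (n ℓ s : ℕ) :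
    (((paths n ℓ).filter (fun w => numZeros w = s + 1)).card : ℝ) =
      pathsZerosGT n ℓ s - pathsZerosGT n ℓ (s + 1) := by
  rw [eq_sub_iff_add_eq]
  norm_cast
  unfold pathsZerosGT
  rw [← card_union_of_disjoint (disjoint_filter.2 fun w _ h => by omega), ← filter_or]
  congr 1
  refine filter_congr fun w _ => ?_
  omega

lemma probZeros_succ (n s : ℕ) :
    probZeros n (s + 1) = zeroTail (n / 2 + 1) (s + 1) / ((s : ℝ) + 1) -
      zeroTail (n / 2 + 1) (s + 2) / ((s : ℝ) + 2) := by
  have h := prob_pathsZerosGT n (s + 1)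
  push_cast at h
  rw [show (s : ℝ) + 2 = s + 1 + 1 by ring, ← h, ← prob_pathsZerosGT, ← mul_sub,
    ← sum_sub_distrib]
  simp only [probZeros, card_filter_numZeros_eq, mul_sub]

lemma zeroTail_succ {N r : ℕ} (hr : r ≤ N) (hN : 0 < N) :
    zeroTail N (r + 1) = zeroTail N r * (1 - r / (2 * N - r)) := by
  have h1 := Nat.choose_succ_right_eq N r
  have h2 := Nat.choose_succ_right_eq (2 * N) r
  have hc : ((2 * N).choose r : ℝ) ≠ 0 := by exact_mod_cast (Nat.choose_pos (by omega)).ne'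
  have hc' : ((2 * N).choose (r + 1) : ℝ) ≠ 0 := by
    exact_mod_cast (Nat.choose_pos (by omega)).ne'
  have hrN : (r : ℝ) ≤ N := by exact_mod_cast hr
  have hN' : (0 : ℝ) < N := by exact_mod_cast hN
  have hd : (2 * N - r : ℝ) ≠ 0 := by linarith
  zify [hr, show r ≤ 2 * N by omega] at h1 h2
  have h1' : (N.choose (r + 1) : ℝ) * (r + 1) = N.choose r * (N - r) := by exact_mod_cast h1
  have h2' : ((2 * N).choose (r + 1) : ℝ) * (r + 1) = (2 * N).choose r * (2 * N - r) := by
    exact_mod_cast h2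
  have hr' : (r + 1 : ℝ) ≠ 0 := by positivity
  unfold zeroTail
  rw [pow_succ]
  field_simp
  apply mul_right_cancel₀ hr'
  linear_combination 2 * ((2 * N).choose r : ℝ) * (2 * N - r) * h1' -
    2 * (N.choose r : ℝ) * (N - r) * h2'

lemma zeroTail_bounds {N r : ℕ} (hr : r ≤ N) (hN : 0 < N) :
    0 ≤ zeroTail N r ∧ zeroTail N r ≤ 1 ∧ 1 - (r : ℝ) ^ 2 / N ≤ zeroTail N r := by
  have hN' : (0 : ℝ) < N := by exact_mod_cast hN
  refine ⟨by unfold zeroTail; positivity, ?_⟩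
  induction r with
  | zero => simp [zeroTail]
  | succ r ih =>
    obtain ⟨h1, h2⟩ := ih (by omega)
    have h0 : 0 ≤ zeroTail N r := by unfold zeroTail; positivity
    have hrN : (r : ℝ) ≤ N := by exact_mod_cast (by omega : r ≤ N)
    have hq0 : 0 ≤ (r : ℝ) / (2 * N - r) := div_nonneg (by positivity) (by linarith)
    have hq : (r : ℝ) / (2 * N - r) ≤ r / N :=
      div_le_div_of_nonneg_left (by positivity) hN' (by linarith)
    rw [zeroTail_succ (by omega) hN]
    refine ⟨by nlinarith, ?_⟩
    have h3 : zeroTail N r * (r / (2 * N - r)) ≤ r / N := by nlinarith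
    have h4 : ((r + 1 : ℕ) : ℝ) ^ 2 / N = (r : ℝ) ^ 2 / N + r / N + (r + 1) / N := by
      push_cast
      ring
    have h5 : 0 ≤ ((r : ℝ) + 1) / N := by positivity
    linarith

lemma abs_probZeros_sub_one_le {n r : ℕ} (hn : 1 ≤ n) (hr : 1 ≤ r) :
    |(r : ℝ) * ((r : ℝ) + 1) * probZeros n r - 1| ≤ 2 * (r : ℝ) ^ 2 / n := by
  obtain ⟨s, rfl⟩ : ∃ s, r = s + 1 := ⟨r - 1, by omega⟩
  set N := n / 2 + 1 with hNdef
  have hN : 0 < N := by omega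
  have hN' : (0 : ℝ) < N := by exact_mod_cast hN
  have hn' : (0 : ℝ) < n := by exact_mod_cast hn
  have hnN : (n : ℝ) ≤ 2 * N := by exact_mod_cast (by omega : n ≤ 2 * N)
  have hle : ((s + 1 : ℕ) : ℝ) ^ 2 / N ≤ 2 * ((s + 1 : ℕ) : ℝ) ^ 2 / n := by
    rw [div_le_div_iff₀ hN' hn']
    nlinarith [sq_nonneg ((s + 1 : ℕ) : ℝ)]
  refine le_trans ?_ hle
  rw [probZeros_succ, ← hNdef]
  rcases le_or_gt (s + 1) N with hs | hs
  · obtain ⟨h0, h1, h2⟩ := zeroTail_bounds hs hN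
    have hsN : ((s + 1 : ℕ) : ℝ) ≤ N := by exact_mod_cast hs
    rw [zeroTail_succ hs hN]
    generalize zeroTail N (s + 1) = b at *
    have hs0 : ((s : ℝ) + 1) ≠ 0 := by positivity
    have hs1 : ((s : ℝ) + 2) ≠ 0 := by positivity
    have hd : (0 : ℝ) < 2 * N - (s + 1 : ℕ) := by linarith
    have hexact : ((s + 1 : ℕ) : ℝ) * (((s + 1 : ℕ) : ℝ) + 1) * (b / ((s : ℝ) + 1) -
        b * (1 - (s + 1 : ℕ) / (2 * N - (s + 1 : ℕ))) / ((s : ℝ) + 2)) =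
        b * (1 + ((s + 1 : ℕ) : ℝ) ^ 2 / (2 * N - (s + 1 : ℕ))) := by
      have hd' := hd.ne'
      push_cast at hd' ⊢
      field_simp
      ring
    have hq0 : 0 ≤ ((s + 1 : ℕ) : ℝ) ^ 2 / (2 * N - (s + 1 : ℕ)) :=
      div_nonneg (by positivity) hd.le
    have hq : ((s + 1 : ℕ) : ℝ) ^ 2 / (2 * N - (s + 1 : ℕ)) ≤ ((s + 1 : ℕ) : ℝ) ^ 2 / N :=
      div_le_div_of_nonneg_left (by positivity) hN' (by linarith)
    rw [hexact, abs_le]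
    constructor <;> nlinarith
  · have hs' : (N : ℝ) ≤ (s + 1 : ℕ) := by exact_mod_cast hs.le
    have hN1 : (1 : ℝ) ≤ N := by exact_mod_cast hN
    simp only [zeroTail, Nat.choose_eq_zero_of_lt hs, Nat.choose_eq_zero_of_lt (hs.trans
      (Nat.lt_succ_self _))]
    simp only [Nat.cast_zero, mul_zero, zero_div, sub_zero, zero_sub, abs_neg, abs_one]
    rw [le_div_iff₀ hN']
    nlinarith

end ZeroProbabilities

/-- Local limit theorem for the number of zeros: for `0 < ε ≤ 1/2` and `A > 0` there is
`K > 0` such that `|r(r+1)·P(Z_n = r) − 1| ≤ K/n^{2ε}` for all `n, r ≥ 1` with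
`r ≤ A·n^{1/2−ε}`; in particular `P(Z_n = r) → 1/(r(r+1))` as `n → ∞` for each fixed
`r ≥ 1`. -/
theorem distribution_of_zeros_asymptotic (ε A : ℝ) (hε0 : 0 < ε) (hε : ε ≤ 1 / 2)
    (hA : 0 < A) :
    (∃ K > (0 : ℝ), ∀ n r : ℕ, 1 ≤ n → 1 ≤ r →
      (r : ℝ) ≤ A * (n : ℝ) ^ ((1 : ℝ) / 2 - ε) →
      |(r : ℝ) * ((r : ℝ) + 1) * probZeros n r - 1| ≤ K / (n : ℝ) ^ (2 * ε))
    ∧ ∀ r : ℕ, 1 ≤ r →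
        Filter.Tendsto (fun n : ℕ => probZeros n r) Filter.atTop
          (nhds (1 / ((r : ℝ) * ((r : ℝ) + 1)))) := by
  constructor
  · refine ⟨2 * A ^ 2, by positivity, fun n r hn hr hrA => ?_⟩
    have hn' : (0 : ℝ) < n := by exact_mod_cast hn
    refine (abs_probZeros_sub_one_le hn hr).trans ?_
    have hsq : (r : ℝ) ^ 2 ≤ A ^ 2 * ((n : ℝ) / (n : ℝ) ^ (2 * ε)) := by
      calc (r : ℝ) ^ 2 ≤ (A * (n : ℝ) ^ ((1 : ℝ) / 2 - ε)) ^ 2 := by gcongr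
        _ = A ^ 2 * ((n : ℝ) / (n : ℝ) ^ (2 * ε)) := by
          rw [mul_pow, ← Real.rpow_mul_natCast hn'.le, show (n : ℝ) / (n : ℝ) ^ (2 * ε) =
            (n : ℝ) ^ (1 - 2 * ε) by rw [Real.rpow_sub hn', Real.rpow_one]]
          congr 2
          push_cast
          ring
    calc 2 * (r : ℝ) ^ 2 / n ≤ 2 * (A ^ 2 * ((n : ℝ) / (n : ℝ) ^ (2 * ε))) / n := by gcongr
      _ = 2 * A ^ 2 / (n : ℝ) ^ (2 * ε) := by field_simp
  · intro r hr
    have hr' : (r : ℝ) * ((r : ℝ) + 1) ≠ 0 := by positivity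
    have h : Filter.Tendsto (fun n : ℕ => (r : ℝ) * ((r : ℝ) + 1) * probZeros n r)
        Filter.atTop (nhds 1) := by
      rw [tendsto_iff_dist_tendsto_zero]
      refine squeeze_zero' (Filter.Eventually.of_forall fun n => dist_nonneg) ?_
        (tendsto_const_div_atTop_nhds_zero_nat (2 * (r : ℝ) ^ 2))
      filter_upwards [Filter.eventually_ge_atTop 1] with n hn
      exact abs_probZeros_sub_one_le hn hr
    refine (h.div_const ((r : ℝ) * ((r : ℝ) + 1))).congr fun n => ?_
    exact mul_div_cancel_left₀ _ hr'
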